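/- arXiv:1407.1546 — 2 statements merged into one kernel-verified Lean document; each statement's English description precedes it below -/
import Mathlib

section
/- Fix an integer k ≥ 1, privacy parameters λ_1,…,λ_k ∈ ℝ with λ_i ≥ 1, an index i ∈ [k], a finite output set 𝒴, and accuracy weights W : {0,1}^k × 𝒴 → ℝ. There exists a party-i decision rule Q* for the randomized response protocol R (i.e., Q*_{x̃,b,y} ≥ 0 with ∑_{y∈𝒴} Q*_{x̃,b,y} = 1 for each x̃ ∈ {0,1}^k and b ∈ {0,1}) such that for every finite transcript set 𝒯, every protocol-compatible {λ_i}-differentially private protocol P over 𝒯, and every party-i decision rule Q for P, the worst-case accuracies satisfy min_{x∈{0,1}^k} ∑_{τ∈𝒯} ∑_{y∈𝒴} W_{x,y} P_{x,τ} Q_{τ,x_i,y} ≤ min_{x∈{0,1}^k} ∑_{x̃∈{0,1}^k} ∑_{y∈𝒴} W_{x,y} R_{x,x̃} Q*_{x̃,x_i,y}; i.e., the randomized response with an optimal decision rule maximizes party i's worst-case accuracy over all protocol-compatible {λ_i}-differentially private protocols and all decision rules. -/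
open Finset

/-- The probability that one-bit randomized response with parameter `l` reports `b` on input `c`. -/
noncomputable def rrKernel (l : ℝ) (b c : Bool) : ℝ := (if b = c then l else 1) / (1 + l)

/-- A one-sided inverse of `rrKernel l` on the vectors satisfying the privacy constraint: the matrix
inverse for `l ≠ 1`, and the identity for `l = 1`. -/
noncomputable def rrInv (l : ℝ) (b c : Bool) : ℝ :=
  if l = 1 then (if b = c then 1 else 0) else (if b = c then l else -1) / (l - 1)

theorem sum_rrInv (l : ℝ) (b : Bool) : ∑ c, rrInv l b c = 1 := by
  by_cases h : l = 1
  · cases b <;> simp [rrInv, h]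
  · have h' : l - 1 ≠ 0 := sub_ne_zero.mpr h
    cases b <;> simp [rrInv, h] <;> field_simp <;> ring

theorem sum_rrInv_mul_nonneg {l : ℝ} (hl : 1 ≤ l) {u : Bool → ℝ} (hu : ∀ b, 0 ≤ u b)
    (hdp : ∀ b c, u b ≤ l * u c) (b : Bool) : 0 ≤ ∑ c, rrInv l b c * u c := by
  by_cases h : l = 1
  · simpa [rrInv, h] using hu b
  · have h' : 0 < l - 1 := sub_pos.mpr (lt_of_le_of_ne hl (Ne.symm h))
    have key : ∑ c, rrInv l b c * u c = (l * u b - u !b) / (l - 1) := by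
      cases b <;> simp [rrInv, h] <;> ring
    rw [key]
    exact div_nonneg (sub_nonneg.mpr (hdp _ _)) h'.le

theorem sum_rrKernel_mul_sum_rrInv_mul {l : ℝ} (hl : 1 ≤ l) {u : Bool → ℝ}
    (hdp : ∀ b c, u b ≤ l * u c) (c : Bool) :
    ∑ b, rrKernel l b c * ∑ d, rrInv l b d * u d = u c := by
  by_cases h : l = 1
  · subst h
    have e : u true = u false := le_antisymm (by simpa using hdp true false)
      (by simpa using hdp false true)
    cases c <;> simp [rrKernel, rrInv, e] <;> ring
  · have h₁ : l - 1 ≠ 0 := sub_ne_zero.mpr h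
    have h₂ : 1 + l ≠ 0 := by positivity
    cases c <;> simp [rrKernel, rrInv, h] <;> field_simp <;> ring

/-- The sum over the cube of a product of coordinate functions factors. -/
theorem sum_cube_prod {k : ℕ} (f : Fin k → Bool → ℝ) :
    ∑ x : Fin k → Bool, ∏ j, f j (x j) = ∏ j, ∑ b, f j b := by
  rw [Finset.prod_univ_sum, Fintype.piFinset_univ]

/-- A nonzero rank-one differentially private column has differentially private factors. -/
theorem factor_le_of_private {k : ℕ} {l : Fin k → ℝ} {u : Fin k → Bool → ℝ}
    (hu : ∀ j b, 0 ≤ u j b)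
    (hdp : ∀ (j : Fin k) (x x' : Fin k → Bool), (∀ m, m ≠ j → x m = x' m) →
      ∏ m, u m (x m) ≤ l j * ∏ m, u m (x' m))
    {x₀ : Fin k → Bool} (hx₀ : ∏ m, u m (x₀ m) ≠ 0) (j : Fin k) (b c : Bool) :
    u j b ≤ l j * u j c := by
  have factor (d : Bool) : ∏ m, u m (Function.update x₀ j d m) =
      u j d * ∏ m ∈ univ.erase j, u m (x₀ m) := by
    rw [← Finset.mul_prod_erase univ _ (mem_univ j), Function.update_self]
    congr 1
    refine Finset.prod_congr rfl fun m hm => ?_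
    rw [Function.update_of_ne (ne_of_mem_erase hm)]
  have hpos : 0 < ∏ m ∈ univ.erase j, u m (x₀ m) :=
    Finset.prod_pos fun m _ => lt_of_le_of_ne (hu m _)
      (Ne.symm (Finset.prod_ne_zero_iff.mp hx₀ m (mem_univ m)))
  have h := hdp j (Function.update x₀ j b) (Function.update x₀ j c) fun m hm => by
    rw [Function.update_of_ne hm, Function.update_of_ne hm]
  rw [factor, factor, ← mul_assoc] at h
  exact le_of_mul_le_mul_right h hpos

/-- A rank-one differentially private column is a nonnegative combination of the columns of
randomized response, with coefficients given by `rrInv`. -/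
theorem rrInv_column {k : ℕ} {l : Fin k → ℝ} (hl : ∀ j, 1 ≤ l j) {p : (Fin k → Bool) → ℝ}
    (hp : ∃ u : Fin k → Bool → ℝ, (∀ j b, 0 ≤ u j b) ∧ ∀ x, p x = ∏ j, u j (x j))
    (hdp : ∀ (j : Fin k) (x x' : Fin k → Bool), (∀ m, m ≠ j → x m = x' m) →
      p x ≤ l j * p x') :
    (∀ z : Fin k → Bool, 0 ≤ ∑ x, (∏ j, rrInv (l j) (z j) (x j)) * p x) ∧
    ∀ x, ∑ z : Fin k → Bool, (∏ j, rrKernel (l j) (z j) (x j)) *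
      ∑ x', (∏ j, rrInv (l j) (z j) (x' j)) * p x' = p x := by
  obtain ⟨u, hu, hpu⟩ := hp
  by_cases hzero : ∀ x, p x = 0
  · simp [hzero]
  · obtain ⟨x₀, hx₀⟩ := not_forall.mp hzero
    simp only [hpu] at hdp hx₀ ⊢
    have hfac := factor_le_of_private hu hdp hx₀
    have hprod (z : Fin k → Bool) :
        ∑ x : Fin k → Bool, (∏ j, rrInv (l j) (z j) (x j)) * ∏ j, u j (x j) =
          ∏ j, ∑ b, rrInv (l j) (z j) b * u j b := by
      simp only [← Finset.prod_mul_distrib]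
      exact sum_cube_prod fun j b => rrInv (l j) (z j) b * u j b
    simp only [hprod]
    refine ⟨fun z => Finset.prod_nonneg fun j _ =>
      sum_rrInv_mul_nonneg (hl j) (hu j) (hfac j) _, fun x => ?_⟩
    simp only [← Finset.prod_mul_distrib]
    rw [sum_cube_prod fun j b => rrKernel (l j) b (x j) * ∑ c, rrInv (l j) b c * u j c]
    exact Finset.prod_congr rfl fun j _ => sum_rrKernel_mul_sum_rrInv_mul (hl j) (hfac j) _

/-- Every protocol-compatible differentially private protocol is a post-processing of
randomized response. -/
theorem exists_postprocessing {k : ℕ} {l : Fin k → ℝ} (hl : ∀ j, 1 ≤ l j)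
    {T : Type*} [Fintype T] {P : (Fin k → Bool) → T → ℝ} (hsum : ∀ x, ∑ τ, P x τ = 1)
    (hcompat : ∀ τ : T, ∃ u : Fin k → Bool → ℝ,
      (∀ j b, 0 ≤ u j b) ∧ ∀ x, P x τ = ∏ j, u j (x j))
    (hdp : ∀ (j : Fin k) (x x' : Fin k → Bool) (τ : T),
      (∀ m, m ≠ j → x m = x' m) → P x τ ≤ l j * P x' τ) :
    ∃ M : (Fin k → Bool) → T → ℝ, (∀ z τ, 0 ≤ M z τ) ∧ (∀ z, ∑ τ, M z τ = 1) ∧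
      ∀ x τ, P x τ = ∑ z : Fin k → Bool, (∏ j, rrKernel (l j) (z j) (x j)) * M z τ := by
  have hcol (τ : T) := rrInv_column hl (hcompat τ) fun j x x' => hdp j x x' τ
  refine ⟨fun z τ => ∑ x, (∏ j, rrInv (l j) (z j) (x j)) * P x τ,
    fun z τ => (hcol τ).1 z, fun z => ?_, fun x τ => ((hcol τ).2 x).symm⟩
  rw [Finset.sum_comm]
  simp only [← Finset.mul_sum, hsum, mul_one]
  rw [sum_cube_prod fun j b => rrInv (l j) (z j) b]
  exact Finset.prod_eq_one fun j _ => sum_rrInv _ _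

/-- The decision rules for transcripts in `S` and outputs in `Y`. -/
def decisionRules (S Y : Type*) [Fintype Y] : Set (S → Bool → Y → ℝ) :=
  Set.univ.pi fun _ => Set.univ.pi fun _ => stdSimplex ℝ Y

theorem mem_decisionRules {S Y : Type*} [Fintype Y] {Q : S → Bool → Y → ℝ} :
    Q ∈ decisionRules S Y ↔ (∀ s b y, 0 ≤ Q s b y) ∧ ∀ s b, ∑ y, Q s b y = 1 := by
  simp only [decisionRules, Set.mem_univ_pi, stdSimplex, Set.mem_ofPred_eq, forall_and]

theorem isCompact_decisionRules (S Y : Type*) [Fintype Y] : IsCompact (decisionRules S Y) :=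
  isCompact_univ_pi fun _ => isCompact_univ_pi fun _ => isCompact_stdSimplex ℝ Y

theorem decisionRules_nonempty (S Y : Type*) [Fintype Y] [Nonempty Y] :
    (decisionRules S Y).Nonempty := by
  classical
  exact ⟨fun _ _ => Pi.single (Classical.arbitrary Y) 1, fun _ _ _ _ => single_mem_stdSimplex ℝ _⟩

/-- **Optimality of randomized response for party `i`'s worst-case accuracy.**
There is a party-`i` decision rule `Qs` for the randomized response protocol such that no
protocol-compatible `{λ_i}`-differentially private protocol with any party-`i` decision
rule achieves a larger worst-case accuracy for party `i`. -/
theorem randomized_response_optimal_worst_case_party (k : ℕ) (hk : 1 ≤ k)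
    (l : Fin k → ℝ) (hl : ∀ i, 1 ≤ l i) (i : Fin k)
    (Y : Type*) [Fintype Y] [Nonempty Y]
    (W : (Fin k → Bool) → Y → ℝ) :
    ∃ Qs : (Fin k → Bool) → Bool → Y → ℝ,
      (∀ xt b y, 0 ≤ Qs xt b y) ∧ (∀ xt b, ∑ y, Qs xt b y = 1) ∧
      ∀ (T : Type) [Fintype T], ∀ P : (Fin k → Bool) → T → ℝ,
        (∀ x τ, 0 ≤ P x τ) →
        (∀ x, ∑ τ, P x τ = 1) →
        (∀ τ : T, ∃ u : Fin k → Bool → ℝ,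
          (∀ j b, 0 ≤ u j b) ∧ ∀ x, P x τ = ∏ j, u j (x j)) →
        (∀ (j : Fin k) (x x' : Fin k → Bool) (τ : T),
          (∀ m, m ≠ j → x m = x' m) → P x τ ≤ l j * P x' τ) →
        ∀ Q : T → Bool → Y → ℝ,
          (∀ τ b y, 0 ≤ Q τ b y) → (∀ τ b, ∑ y, Q τ b y = 1) →
          Finset.univ.inf' Finset.univ_nonempty
            (fun x : Fin k → Bool => ∑ τ : T, ∑ y : Y, W x y * P x τ * Q τ (x i) y) ≤
          Finset.univ.inf' Finset.univ_nonempty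
            (fun x : Fin k → Bool => ∑ xt : Fin k → Bool, ∑ y : Y,
              W x y * (∏ j, (if xt j = x j then l j else 1) / (1 + l j)) * Qs xt (x i) y) := by
  obtain ⟨Qs, hQs, hmax⟩ := (isCompact_decisionRules (Fin k → Bool) Y).exists_isMaxOn
    (decisionRules_nonempty _ _)
    (f := fun Q => Finset.univ.inf' Finset.univ_nonempty
      (fun x : Fin k → Bool => ∑ xt : Fin k → Bool, ∑ y : Y,
        W x y * (∏ j, (if xt j = x j then l j else 1) / (1 + l j)) * Q xt (x i) y))
    (Continuous.continuousOn <| Continuous.finset_inf'_apply _ fun x _ => by fun_prop)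
  refine ⟨Qs, (mem_decisionRules.mp hQs).1, (mem_decisionRules.mp hQs).2, ?_⟩
  intro T _ P _ hsum hcompat hdp Q hQ hQsum
  obtain ⟨M, hM, hMsum, hPM⟩ := exists_postprocessing hl hsum hcompat hdp
  have hmem : (fun z b y => ∑ τ, M z τ * Q τ b y) ∈ decisionRules (Fin k → Bool) Y := by
    refine mem_decisionRules.mpr ⟨fun z b y => Finset.sum_nonneg fun τ _ =>
      mul_nonneg (hM z τ) (hQ τ b y), fun z b => ?_⟩
    rw [Finset.sum_comm]
    simp only [← Finset.mul_sum, hQsum, mul_one, hMsum]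
  refine le_trans (le_of_eq ?_) (hmax hmem)
  congr 1
  funext x
  simp only [hPM, rrKernel, Finset.mul_sum, Finset.sum_mul]
  rw [Finset.sum_comm' (t' := univ) (s' := fun _ => univ) (by simp)]
  rw [Finset.sum_comm (s := (univ : Finset (Fin k → Bool)))]
  refine Finset.sum_congr rfl fun y _ => ?_
  rw [Finset.sum_comm]
  refine Finset.sum_congr rfl fun z _ => Finset.sum_congr rfl fun τ _ => ?_
  ring
end

section
/- Fix integers k ≥ 1 and a real λ ≥ 1. For every finite transcript set 𝒯, every protocol-compatible protocol P over 𝒯 that is λ-differentially private for every party, and every row-stochastic decision rule Q ∈ [0,1]^{𝒯×{0,1}}, the worst-case accuracy for computing the XOR function with 0–1 accuracy weights satisfies min_{x∈{0,1}^k} ∑_{τ∈𝒯} P_{x,τ} Q_{τ, ⊕x} ≤ ( ∑_{i=0}^{⌊k/2⌋} C(k,2i) λ^{k−2i} ) / (1+λ)^k, where ⊕x denotes x_1 ⊕ ⋯ ⊕ x_k and C(k,2i) is the binomial coefficient. -/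
open Finset

/-- The XOR of the coordinates of `x ∈ {0,1}^k`. -/
def xorBits {k : ℕ} (x : Fin k → Bool) : Bool :=
  decide ((Finset.univ.filter fun i => x i = true).card % 2 = 1)

/-- The sign of the XOR is the product of the signs of the bits. -/
lemma prod_sign_eq_xorBits {k : ℕ} (x : Fin k → Bool) :
    (∏ i, if x i = true then (-1 : ℝ) else 1) = if xorBits x = true then -1 else 1 := by
  rw [Finset.prod_ite]
  simp only [Finset.prod_const, one_pow, mul_one, xorBits, decide_eq_true_eq]
  split_ifs with h
  · exact (Nat.odd_iff.2 h).neg_one_pow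
  · exact (Nat.not_odd_iff_even.1 (mt Nat.odd_iff.1 h)).neg_one_pow

lemma sum_even_choose_mul_pow (k : ℕ) (a : ℝ) :
    ∑ i ∈ Finset.range (k / 2 + 1), (k.choose (2 * i) : ℝ) * a ^ (k - 2 * i) =
      ((a + 1) ^ k + (a - 1) ^ k) / 2 := by
  have hsum : ∑ m ∈ (Finset.range (k + 1)).filter Even, (k.choose m : ℝ) * a ^ (k - m) =
      ∑ i ∈ Finset.range (k / 2 + 1), (k.choose (2 * i) : ℝ) * a ^ (k - 2 * i) := by
    refine (Finset.sum_nbij' (fun i => 2 * i) (fun m => m / 2) ?_ ?_ ?_ ?_ ?_).symm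
    · intro i hi
      simp only [Finset.mem_filter, Finset.mem_range] at hi ⊢
      exact ⟨by omega, even_two_mul i⟩
    · intro m hm
      simp only [Finset.mem_filter, Finset.mem_range] at hm ⊢
      omega
    · intro i _
      simp
    · intro m hm
      exact Nat.two_mul_div_two_of_even (Finset.mem_filter.1 hm).2
    · intro i _
      rfl
  rw [← hsum, Finset.sum_filter, add_comm a 1, show a - 1 = -1 + a by ring, add_pow, add_pow,
    ← Finset.sum_add_distrib, Finset.sum_div]
  refine Finset.sum_congr rfl fun m _ => ?_
  split_ifs with h
  · rw [h.neg_one_pow]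
    ring
  · rw [(Nat.not_even_iff_odd.1 h).neg_one_pow]
    ring

lemma sum_prod_bool {k : ℕ} (v : Fin k → Bool → ℝ) :
    ∑ x : Fin k → Bool, ∏ i, v i (x i) = ∏ i, (v i false + v i true) := by
  have h := Finset.prod_univ_sum (fun _ : Fin k => (Finset.univ : Finset Bool)) v
  rw [Fintype.piFinset_univ] at h
  simp only [Fintype.sum_bool] at h
  rw [← h]
  exact Finset.prod_congr rfl fun i _ => add_comm _ _

lemma sum_sign_mul_prod_bool {k : ℕ} (u : Fin k → Bool → ℝ) :
    ∑ x : Fin k → Bool, (if xorBits x = true then (-1 : ℝ) else 1) * ∏ i, u i (x i) =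
      ∏ i, (u i false - u i true) := by
  simp_rw [← prod_sign_eq_xorBits, ← Finset.prod_mul_distrib]
  rw [sum_prod_bool fun i b => (if b = true then (-1 : ℝ) else 1) * u i b]
  exact Finset.prod_congr rfl fun i _ => by simp [sub_eq_add_neg]

/-- The XOR correlation of a differentially private product column is small compared with its
total mass. -/
lemma abs_prod_sub_le_of_private {k : ℕ} {lam : ℝ} (hlam : 1 ≤ lam) {u : Fin k → Bool → ℝ}
    (hu : ∀ i b, 0 ≤ u i b)
    (hdp : ∀ (i : Fin k) (x x' : Fin k → Bool),
      (∀ j, j ≠ i → x j = x' j) → ∏ j, u j (x j) ≤ lam * ∏ j, u j (x' j)) :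
    |∏ i, (u i false - u i true)| ≤
      ((lam - 1) / (1 + lam)) ^ k * ∏ i, (u i false + u i true) := by
  have hr : 0 ≤ (lam - 1) / (1 + lam) := div_nonneg (by linarith) (by linarith)
  by_cases hzero : ∃ i, ∀ b, u i b = 0
  · obtain ⟨i, hi⟩ := hzero
    rw [Finset.prod_eq_zero (Finset.mem_univ i) (by simp [hi]), abs_zero]
    exact mul_nonneg (pow_nonneg hr k)
      (Finset.prod_nonneg fun j _ => add_nonneg (hu j _) (hu j _))
  push Not at hzero
  choose y hy using hzero
  have hratio (i : Fin k) (b c : Bool) : u i b ≤ lam * u i c := by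
    have h := hdp i (Function.update y i b) (Function.update y i c)
      fun j hj => by simp [hj]
    have hsplit (d : Bool) : ∏ j, u j (Function.update y i d j) =
        u i d * ∏ j ∈ Finset.univ.erase i, u j (y j) := by
      rw [← Finset.mul_prod_erase _ _ (Finset.mem_univ i), Function.update_self]
      congr 1
      refine Finset.prod_congr rfl fun j hj => ?_
      rw [Function.update_of_ne (Finset.ne_of_mem_erase hj)]
    rw [hsplit, hsplit, ← mul_assoc] at h
    exact le_of_mul_le_mul_right h
      (Finset.prod_pos fun j _ => lt_of_le_of_ne (hu j _) (hy j).symm)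
  have hpow : ((lam - 1) / (1 + lam)) ^ k = ∏ _i : Fin k, (lam - 1) / (1 + lam) := by
    rw [Finset.prod_const, Finset.card_univ, Fintype.card_fin]
  rw [Finset.abs_prod, hpow, ← Finset.prod_mul_distrib]
  refine Finset.prod_le_prod (fun i _ => abs_nonneg _) fun i _ => ?_
  have h₁ := hratio i false true
  have h₂ := hratio i true false
  have hpos : 0 < 1 + lam := by linarith
  rw [div_mul_eq_mul_div, abs_le, ← neg_div, div_le_iff₀ hpos, le_div_iff₀ hpos]
  constructor <;> linarith

/-- The part of the total accuracy, summed over all inputs, contributed by one transcript. -/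
lemma sum_mul_decision_le_of_private {k : ℕ} {lam : ℝ} (hlam : 1 ≤ lam) {p : (Fin k → Bool) → ℝ}
    (hcompat : ∃ u : Fin k → Bool → ℝ, (∀ i b, 0 ≤ u i b) ∧ ∀ x, p x = ∏ i, u i (x i))
    (hdp : ∀ (i : Fin k) (x x' : Fin k → Bool),
      (∀ j, j ≠ i → x j = x' j) → p x ≤ lam * p x')
    {q : Bool → ℝ} (hq : ∀ b, 0 ≤ q b) (hqsum : q false + q true = 1) :
    ∑ x, p x * q (xorBits x) ≤ (1 + ((lam - 1) / (1 + lam)) ^ k) / 2 * ∑ x, p x := by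
  obtain ⟨u, hu, hp⟩ := hcompat
  obtain rfl : p = fun x => ∏ i, u i (x i) := funext hp
  have hcorr := abs_prod_sub_le_of_private hlam hu hdp
  rw [← sum_sign_mul_prod_bool, ← sum_prod_bool] at hcorr
  have hsum : ∑ x : Fin k → Bool, (∏ i, u i (x i)) * q (xorBits x) =
      (∑ x : Fin k → Bool, ∏ i, u i (x i)) / 2 + (q false - q true) / 2 *
        ∑ x : Fin k → Bool, (if xorBits x = true then (-1 : ℝ) else 1) * ∏ i, u i (x i) := by
    rw [Finset.sum_div, Finset.mul_sum, ← Finset.sum_add_distrib]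
    refine Finset.sum_congr rfl fun x _ => ?_
    cases xorBits x
    · rw [if_neg Bool.false_ne_true]
      linear_combination ((∏ i, u i (x i)) / 2) * hqsum
    · rw [if_pos rfl]
      linear_combination ((∏ i, u i (x i)) / 2) * hqsum
  have hbias : |q false - q true| ≤ 1 :=
    abs_le.2 ⟨by linarith [hq false], by linarith [hq true]⟩
  have hmul (d : ℝ) : (q false - q true) * d ≤ |d| := (le_abs_self _).trans
    ((abs_mul (q false - q true) d).le.trans (mul_le_of_le_one_left (abs_nonneg d) hbias))
  dsimp only
  rw [hsum]
  linarith [(hmul _).trans hcorr]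

/-- **Upper bound on the worst-case accuracy of private multi-party XOR computation.**
For any protocol-compatible protocol that is `λ`-differentially private for every party
and any row-stochastic decision rule, the worst-case accuracy for computing the XOR of the
`k` bits with 0–1 accuracy weights is at most
`(∑_{i=0}^{⌊k/2⌋} C(k,2i) λ^{k−2i}) / (1+λ)^k`. -/
theorem xor_worst_case_accuracy_upper_bound (k : ℕ) (hk : 1 ≤ k)
    (lam : ℝ) (hlam : 1 ≤ lam)
    (T : Type*) [Fintype T] (P : (Fin k → Bool) → T → ℝ)
    (hPnn : ∀ x τ, 0 ≤ P x τ)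
    (hProw : ∀ x, ∑ τ, P x τ = 1)
    (hPcompat : ∀ τ : T, ∃ u : Fin k → Bool → ℝ,
      (∀ i b, 0 ≤ u i b) ∧ ∀ x, P x τ = ∏ i, u i (x i))
    (hPdp : ∀ (i : Fin k) (x x' : Fin k → Bool) (τ : T),
      (∀ j, j ≠ i → x j = x' j) → P x τ ≤ lam * P x' τ)
    (Q : T → Bool → ℝ)
    (hQnn : ∀ τ b, 0 ≤ Q τ b) (hQrow : ∀ τ, Q τ false + Q τ true = 1) :
    Finset.univ.inf' Finset.univ_nonempty
        (fun x : Fin k → Bool => ∑ τ : T, P x τ * Q τ (xorBits x)) ≤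
      (∑ i ∈ Finset.range (k / 2 + 1), (k.choose (2 * i) : ℝ) * lam ^ (k - 2 * i)) /
        (1 + lam) ^ k := by
  have hcard : (0 : ℝ) < ∑ _x : Fin k → Bool, (1 : ℝ) := by simp
  rw [sum_even_choose_mul_pow]
  set m := Finset.univ.inf' Finset.univ_nonempty
    (fun x : Fin k → Bool => ∑ τ : T, P x τ * Q τ (xorBits x))
  refine le_of_mul_le_mul_right ?_ hcard
  calc m * ∑ _x : Fin k → Bool, (1 : ℝ)
      = ∑ _x : Fin k → Bool, m := by rw [Finset.mul_sum, mul_one]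
    _ ≤ ∑ x : Fin k → Bool, ∑ τ, P x τ * Q τ (xorBits x) :=
        Finset.sum_le_sum fun x hx => Finset.inf'_le _ hx
    _ = ∑ τ, ∑ x : Fin k → Bool, P x τ * Q τ (xorBits x) := Finset.sum_comm
    _ ≤ ∑ τ, (1 + ((lam - 1) / (1 + lam)) ^ k) / 2 * ∑ x, P x τ :=
        Finset.sum_le_sum fun τ _ => sum_mul_decision_le_of_private hlam (hPcompat τ)
          (fun i x x' => hPdp i x x' τ) (hQnn τ) (hQrow τ)
    _ = (1 + ((lam - 1) / (1 + lam)) ^ k) / 2 * ∑ _x : Fin k → Bool, (1 : ℝ) := by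
        rw [← Finset.mul_sum, Finset.sum_comm]
        simp_rw [hProw]
    _ = ((lam + 1) ^ k + (lam - 1) ^ k) / 2 / (1 + lam) ^ k * ∑ _x : Fin k → Bool, (1 : ℝ) := by
        have hpos : 0 < 1 + lam := by linarith
        rw [div_pow, add_comm lam 1]
        field_simp
end
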